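/- Let 𝒯 be a geodesic tube of direction β∨ with centerline ℒ. Then ℒ intersects some alcove. In particular, if an element w of the affine Weyl group W^aff fixes ℒ pointwise, then w is the identity. -/

import Mathlib

open scoped RealInnerProductSpace

noncomputable section

/-- The ambient Euclidean space of rank `m`.  Via the fixed `W`-invariant inner product we
identify the space `V` containing the root system with its dual `V*`; the affine space `A`
underlying `V*` is then the Euclidean space itself. -/
abbrev E (m : ℕ) := EuclideanSpace ℝ (Fin m)

variable {m : ℕ}

/-- The coroot `α∨ = 2α/(α,α)` of a vector `α` (under the identification of `V` with `V*`
given by the invariant inner product). -/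
def coroot (α : E m) : E m := (2 / ⟪α, α⟫) • α

/-- The affine reflection `s_{α,k}(x) = x - (⟨α,x⟩ - k) α∨` as a function. -/
def affReflFun (α : E m) (k : ℤ) : E m → E m := fun x => x - (⟪α, x⟫ - (k : ℝ)) • coroot α

lemma affReflFun_involutive (α : E m) (k : ℤ) : Function.Involutive (affReflFun α k) := by
  intro x
  by_cases h : α = 0
  · simp [affReflFun, coroot, h]
  · have hαα : ⟪α, α⟫ ≠ (0:ℝ) := (inner_self_ne_zero (𝕜 := ℝ)).mpr h
    have h2 : ⟪α, coroot α⟫ = (2:ℝ) := by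
      unfold coroot
      rw [real_inner_smul_right, div_mul_cancel₀ _ hαα]
    have key : ∀ y : E m, ∀ s : ℝ, ⟪α, y - s • coroot α⟫ = ⟪α, y⟫ - 2 * s := by
      intro y s
      rw [inner_sub_right, real_inner_smul_right, h2]
      ring
    show affReflFun α k (x - (⟪α, x⟫ - (k:ℝ)) • coroot α) = x
    unfold affReflFun
    rw [key]
    rw [sub_sub, ← add_smul]
    rw [show (⟪α, x⟫ - (k:ℝ)) + (⟪α, x⟫ - 2 * (⟪α, x⟫ - (k:ℝ)) - (k:ℝ)) = 0 by ring]
    simp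

/-- The affine reflection `s_{α,k}` as a permutation of the affine space. -/
def affRefl (α : E m) (k : ℤ) : Equiv.Perm (E m) := (affReflFun_involutive α k).toPerm

/-- The affine Weyl group of a set of roots `Φ`: the group generated by all affine
reflections `s_{α,k}`, `α ∈ Φ`, `k ∈ ℤ`. -/
def Waff (Φ : Set (E m)) : Subgroup (Equiv.Perm (E m)) :=
  Subgroup.closure {w | ∃ α ∈ Φ, ∃ k : ℤ, w = affRefl α k}

/-- `Φ` is a reduced (crystallographic) root system spanning the ambient space. -/
structure IsRootSystem (Φ : Set (E m)) : Prop where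
  finite : Φ.Finite
  ne_zero : ∀ α ∈ Φ, α ≠ (0 : E m)
  span_eq_top : Submodule.span ℝ Φ = ⊤
  reflect_mem : ∀ α ∈ Φ, ∀ β ∈ Φ, β - ⟪α, β⟫ • coroot α ∈ Φ
  crystallographic : ∀ α ∈ Φ, ∀ β ∈ Φ, ∃ z : ℤ, ⟪α, coroot β⟫ = (z : ℝ)
  reduced : ∀ α ∈ Φ, ∀ t : ℝ, t • α ∈ Φ → t = 1 ∨ t = -1

/-- `B` is a system of simple roots of `Φ`. -/
structure IsSimpleSystem (Φ : Set (E m)) (B : Fin m → E m) : Prop where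
  mem : ∀ i, B i ∈ Φ
  indep : LinearIndependent ℝ B
  decomp : ∀ α ∈ Φ, (∃ c : Fin m → ℤ, α = ∑ j, (c j : ℝ) • B j ∧ ∀ j, 0 ≤ c j) ∨
                    (∃ c : Fin m → ℤ, α = ∑ j, (c j : ℝ) • B j ∧ ∀ j, c j ≤ 0)

/-- `ω` is the system of fundamental coweights relative to the simple roots `B`,
i.e. `⟨α_i, ω_j∨⟩ = δ_{ij}`. -/
def IsFundamentalCoweights (B ω : Fin m → E m) : Prop :=
  ∀ i j, ⟪B i, ω j⟫ = if i = j then (1 : ℝ) else 0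

/-- The wall `H_{α,k} = {x : ⟨α,x⟩ = k}`. -/
def wall (α : E m) (k : ℤ) : Set (E m) := {x | ⟪α, x⟫ = (k : ℝ)}

/-- The union of all walls of the root system `Φ`. -/
def allWalls (Φ : Set (E m)) : Set (E m) := ⋃ α ∈ Φ, ⋃ k : ℤ, wall α k

/-- An alcove: a connected component of the complement of the union of all walls. -/
def IsAlcove (Φ : Set (E m)) (C : Set (E m)) : Prop :=
  ∃ x ∈ (allWalls Φ)ᶜ, C = connectedComponentIn (allWalls Φ)ᶜ x

/-- The set `𝒲` of walls removed when forming geodesic tubes of direction `β∨`: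
all walls `H_{α,k}` with `⟨α, β∨⟩ = 0` (equivalently `α ∈ Φ_I`). -/
def tubeWalls (Φ : Set (E m)) (β : E m) : Set (E m) :=
  ⋃ α ∈ {α ∈ Φ | ⟪α, β⟫ = (0:ℝ)}, ⋃ k : ℤ, wall α k

/-- A geodesic tube of direction `β∨`: a connected component of `A ∖ ⋃𝒲`. -/
def IsGeodesicTube (Φ : Set (E m)) (β : E m) (T : Set (E m)) : Prop :=
  ∃ x ∈ (tubeWalls Φ β)ᶜ, T = connectedComponentIn (tubeWalls Φ β)ᶜ x

/-- `d_γ = inf_x d(x, γx)`. -/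
def minDisp (f : E m → E m) : ℝ := ⨅ x, dist x (f x)

/-- `Min(γ) = {x : d(x,γx) = d_γ}`. -/
def minSet (f : E m → E m) : Set (E m) := {x | dist x (f x) = minDisp f}

/-- A hyperbolic isometry: semisimple (`Min` nonempty) with `d_γ > 0`. -/
def IsHyperbolic (f : E m → E m) : Prop := (minSet f).Nonempty ∧ 0 < minDisp f

/-- `v` is the vector by which `γ` translates its min set. -/
def HasTransVec (f : E m → E m) (v : E m) : Prop := ∀ x ∈ minSet f, f x = x + v

/-- `x` is the barycenter of the polysimplex `s`: the average of the vertices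
(extreme points of the closure) of `s`. -/
def IsBarycenter (s : Set (E m)) (x : E m) : Prop :=
  ∃ F : Finset (E m), (F : Set (E m)) = Set.extremePoints ℝ (closure s) ∧ F.Nonempty ∧
    x = (F.card : ℝ)⁻¹ • ∑ y ∈ F, y

open scoped RealInnerProductSpace

lemma affRefl_apply {m : ℕ} (α : E m) (k : ℤ) (x : E m) :
    affRefl α k x = x - (⟪α, x⟫ - (k : ℝ)) • coroot α := rfl

lemma affRefl_mul_self {m : ℕ} (α : E m) (k : ℤ) : affRefl α k * affRefl α k = 1 := by
  ext1 x
  exact affReflFun_involutive α k x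

lemma affRefl_apply_apply {m : ℕ} (α : E m) (k : ℤ) (x : E m) :
    affRefl α k (affRefl α k x) = x := affReflFun_involutive α k x

/-- affine functional -/
def af {m : ℕ} (a : E m × ℤ) (x : E m) : ℝ := ⟪a.1, x⟫ - (a.2 : ℝ)

/-- reflection attached to a pair -/
def rf {m : ℕ} (a : E m × ℤ) : Equiv.Perm (E m) := affRefl a.1 a.2

lemma rf_apply {m : ℕ} (a : E m × ℤ) (x : E m) : rf a x = x - (af a x) • coroot a.1 := rfl

lemma rf_rf {m : ℕ} (a : E m × ℤ) (x : E m) : rf a (rf a x) = x := affReflFun_involutive _ _ x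

lemma rf_mul_self {m : ℕ} (a : E m × ℤ) : rf a * rf a = 1 := affRefl_mul_self _ _

lemma af_rf {m : ℕ} (a b : E m × ℤ) (x : E m) :
    af b (rf a x) = af b x - af a x * (2 * ⟪a.1, b.1⟫ / ⟪a.1, a.1⟫) := by
  rw [rf_apply]
  unfold af coroot
  rw [inner_sub_right, real_inner_smul_right, real_inner_smul_right, real_inner_comm a.1 b.1]
  ring

/-- Transport of pairs by reflections. -/
lemma exists_refl {m : ℕ} {Φ : Set (E m)} (hΦ : IsRootSystem Φ) (a b : E m × ℤ)
    (ha : a.1 ∈ Φ) (hb : b.1 ∈ Φ) :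
    ∃ c : E m × ℤ, c.1 ∈ Φ ∧ (∀ x, af c x = af b (rf a x)) ∧ rf c = rf a * rf b * rf a ∧
      c.1 = b.1 - (2 * ⟪a.1, b.1⟫ / ⟪a.1, a.1⟫) • a.1 ∧ ⟪c.1, c.1⟫ = ⟪b.1, b.1⟫ := by
  obtain ⟨z, hz⟩ := hΦ.crystallographic b.1 hb a.1 ha
  have hA : ⟪a.1, a.1⟫ ≠ (0:ℝ) := (inner_self_ne_zero (𝕜 := ℝ)).mpr (hΦ.ne_zero _ ha)
  have hz' : 2 * ⟪a.1, b.1⟫ / ⟪a.1, a.1⟫ = (z : ℝ) := by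
    rw [← hz, coroot, real_inner_smul_right, real_inner_comm]; ring
  have hmem := hΦ.reflect_mem a.1 ha b.1 hb
  have hc1 : b.1 - ⟪a.1, b.1⟫ • coroot a.1 = b.1 - (2 * ⟪a.1, b.1⟫ / ⟪a.1, a.1⟫) • a.1 := by
    rw [coroot, smul_smul]; congr 2; ring
  rw [hc1] at hmem
  have hnorm : ⟪b.1 - (2 * ⟪a.1, b.1⟫ / ⟪a.1, a.1⟫) • a.1,
      b.1 - (2 * ⟪a.1, b.1⟫ / ⟪a.1, a.1⟫) • a.1⟫ = ⟪b.1, b.1⟫ := by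
    simp only [inner_sub_left, inner_sub_right, real_inner_smul_left, real_inner_smul_right]
    rw [real_inner_comm a.1 b.1]
    field_simp
    ring
  have haf : ∀ x, af (b.1 - (2 * ⟪a.1, b.1⟫ / ⟪a.1, a.1⟫) • a.1, b.2 - z * a.2) x
      = af b (rf a x) := by
    intro x
    rw [af_rf, hz']
    simp only [af, inner_sub_left, real_inner_smul_left]
    push_cast
    ring
  refine ⟨(b.1 - (2 * ⟪a.1, b.1⟫ / ⟪a.1, a.1⟫) • a.1, b.2 - z * a.2), hmem, haf, ?_, rfl, hnorm⟩
  ext1 x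
  rw [Equiv.Perm.mul_apply, Equiv.Perm.mul_apply]
  have h1 : rf b (rf a x) = rf a x - af b (rf a x) • coroot b.1 := rf_apply _ _
  rw [rf_apply, haf]
  have h2 : ∀ (y v : E m) , rf a (y - v) = rf a y - (v - ⟪a.1, v⟫ • coroot a.1) := by
    intro y v
    simp only [rf_apply, af, inner_sub_right, sub_smul]
    abel
  rw [h1, h2, rf_rf]
  congr 1
  rw [inner_smul_right, mul_smul, ← smul_sub]
  congr 1
  unfold coroot
  simp only
  rw [hnorm, smul_sub, real_inner_smul_right]
  simp only [smul_smul]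
  congr 2
  ring

lemma rf_eq_of_smul {m : ℕ} (a b : E m × ℤ) (c : ℝ) (hc : c ≠ 0) (h1 : b.1 = c • a.1)
    (h2 : (b.2 : ℝ) = c * a.2) : rf b = rf a := by
  ext1 x
  rw [rf_apply, rf_apply]
  congr 1
  unfold af coroot
  rw [h1, h2]
  simp only [real_inner_smul_left, real_inner_smul_right, smul_smul]
  congr 1
  by_cases hA : ⟪a.1, a.1⟫ = (0:ℝ)
  · rw [hA]; simp
  · field_simp

/-- squared distance to wall -/
def sd {m : ℕ} (p : E m) (a : E m × ℤ) : ℝ := (af a p) ^ 2 / ⟪a.1, a.1⟫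

/-- simple pairs with respect to `p` -/
def Simp {m : ℕ} (Φ : Set (E m)) (p : E m) (a : E m × ℤ) : Prop :=
  a.1 ∈ Φ ∧ ∀ b : E m × ℤ, b.1 ∈ Φ → af b p * af b (rf a p) < 0 → rf b = rf a

lemma descent_aux {A Bb c u v : ℝ} (hA : 0 < A) (hB : 0 < Bb) (hcs : c ^ 2 ≤ A * Bb)
    (h1 : v * (v - u * (2 * c / A)) < 0) (h2 : v * (v - u * c / A) ≤ 0)
    (h3 : ¬ (c ^ 2 = A * Bb ∧ v = u * c / A)) :
    v ^ 2 / Bb < u ^ 2 / A ∧ (u - v * (2 * c / Bb)) ^ 2 / A < u ^ 2 / A := by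
  have hv : v ≠ 0 := by rintro rfl; simp at h1
  have e1 : v ^ 2 * A < 2 * (u * v * c) := by
    have : v * (v - u * (2 * c / A)) = (v ^ 2 * A - 2 * (u * v * c)) / A := by field_simp
    rw [this, div_neg_iff] at h1
    rcases h1 with h | h <;> linarith [h.1, h.2]
  have e2 : v ^ 2 * A ≤ u * v * c := by
    have : v * (v - u * c / A) = (v ^ 2 * A - (u * v * c)) / A := by field_simp
    rw [this, div_nonpos_iff] at h2
    rcases h2 with h | h <;> linarith [h.1, h.2]
  have hv2 : 0 < v ^ 2 := by positivity
  have hw : 0 < u * v * c := by nlinarith [mul_pos hv2 hA]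
  have hc0 : c ≠ 0 := by rintro rfl; simp at hw
  have hc2 : 0 < c ^ 2 := by positivity
  -- strictness
  have e3 : v ^ 2 * c ^ 2 < u * v * c * Bb := by
    by_cases hs : c ^ 2 = A * Bb
    · have hne : v ≠ u * c / A := fun h => h3 ⟨hs, h⟩
      have : v ^ 2 * A < u * v * c := by
        refine lt_of_le_of_ne e2 fun h => hne ?_
        field_simp
        have : v * (v * A) = v * (u * c) := by linarith
        exact mul_left_cancel₀ hv this
      rw [hs]
      nlinarith
    · have : c ^ 2 < A * Bb := lt_of_le_of_ne hcs hs
      nlinarith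
  constructor
  · rw [div_lt_div_iff₀ hB hA]
    -- (v^2 A)(v^2 c^2) < (uvc)(uvc) Bb
    have : v ^ 2 * c ^ 2 * (v ^ 2 * A) < v ^ 2 * c ^ 2 * (u ^ 2 * Bb) := by
      calc v ^ 2 * c ^ 2 * (v ^ 2 * A) ≤ v ^ 2 * c ^ 2 * (u * v * c) := by gcongr
        _ < u * v * c * Bb * (u * v * c) := by gcongr
        _ = _ := by ring
    exact lt_of_mul_lt_mul_left this (by positivity)
  · rw [div_lt_div_iff_of_pos_right hA]
    have : u ^ 2 - (u - v * (2 * c / Bb)) ^ 2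
        = 4 * (u * v * c * Bb - v ^ 2 * c ^ 2) / Bb ^ 2 := by
      field_simp; ring
    have h4 : 0 < 4 * (u * v * c * Bb - v ^ 2 * c ^ 2) / Bb ^ 2 := by
      apply div_pos _ (by positivity)
      linarith
    linarith

lemma descent {m : ℕ} {Φ : Set (E m)} (hΦ : IsRootSystem Φ) (p : E m) (a : E m × ℤ)
    (ha : a.1 ∈ Φ) (hs : ¬ Simp Φ p a) :
    ∃ b c : E m × ℤ, b.1 ∈ Φ ∧ c.1 ∈ Φ ∧ sd p b < sd p a ∧ sd p c < sd p a ∧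
      rf a = rf b * rf c * rf b := by
  have hpos : ∀ b : E m × ℤ, b.1 ∈ Φ → (0:ℝ) < ⟪b.1, b.1⟫ := fun b hb =>
    real_inner_self_pos.mpr (hΦ.ne_zero _ hb)
  have key : ∀ b : E m × ℤ, b.1 ∈ Φ → af b p * af b (rf a p) < 0 → rf b ≠ rf a →
      af b p * (af b p - af a p * ⟪a.1, b.1⟫ / ⟪a.1, a.1⟫) ≤ 0 →
      ∃ b c : E m × ℤ, b.1 ∈ Φ ∧ c.1 ∈ Φ ∧ sd p b < sd p a ∧ sd p c < sd p a ∧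
      rf a = rf b * rf c * rf b := by
    intro b hb h1 hne h2
    obtain ⟨c, hc, hcaf, hcrf, -, hcn⟩ := exists_refl hΦ b a hb ha
    rw [af_rf] at h1
    have hA := hpos a ha
    have hB := hpos b hb
    have hcs : ⟪a.1, b.1⟫ ^ 2 ≤ ⟪a.1, a.1⟫ * (⟪b.1, b.1⟫ : ℝ) := by
      have := real_inner_mul_inner_self_le a.1 b.1
      nlinarith
    have h3 : ¬ ((⟪a.1, b.1⟫ : ℝ) ^ 2 = ⟪a.1, a.1⟫ * (⟪b.1, b.1⟫ : ℝ) ∧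
        af b p = af a p * ⟪a.1, b.1⟫ / ⟪a.1, a.1⟫) := by
      rintro ⟨e1, e2⟩
      apply hne
      have hb1 : b.1 = ((⟪a.1, b.1⟫ : ℝ) / ⟪a.1, a.1⟫) • a.1 := by
        rw [← sub_eq_zero, ← inner_self_eq_zero (𝕜 := ℝ)]
        simp only [inner_sub_left, inner_sub_right, real_inner_smul_left, real_inner_smul_right]
        rw [real_inner_comm a.1 b.1]
        field_simp
        linarith
      have hc0 : (⟪a.1, b.1⟫ : ℝ) / ⟪a.1, a.1⟫ ≠ 0 := by
        intro h0
        rw [h0, zero_smul] at hb1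
        exact hΦ.ne_zero _ hb hb1
      refine rf_eq_of_smul a b _ hc0 hb1 ?_
      have e3 : af b p = ((⟪a.1, b.1⟫ : ℝ) / ⟪a.1, a.1⟫) * ⟪a.1, p⟫ - b.2 := by
        rw [← real_inner_smul_left, ← hb1]; rfl
      rw [e3] at e2
      unfold af at e2
      linear_combination -e2
    obtain ⟨r1, r2⟩ := descent_aux hA hB hcs h1 h2 h3
    refine ⟨b, c, hb, hc, r1, ?_, ?_⟩
    · unfold sd
      rw [hcaf, hcn, af_rf, real_inner_comm a.1 b.1]
      exact r2
    · rw [hcrf]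
      simp only [mul_assoc, rf_mul_self, mul_one]
      rw [← mul_assoc, rf_mul_self, one_mul]
  have : ∃ b : E m × ℤ, b.1 ∈ Φ ∧ af b p * af b (rf a p) < 0 ∧ rf b ≠ rf a := by
    by_contra hcon
    push Not at hcon
    exact hs ⟨ha, hcon⟩
  obtain ⟨b, hb, h1, hne⟩ := this
  by_cases h2 : af b p * (af b p - af a p * ⟪a.1, b.1⟫ / ⟪a.1, a.1⟫) ≤ 0
  · exact key b hb h1 hne h2
  · push Not at h2
    obtain ⟨c, hc, hcaf, hcrf, hc1, hcn⟩ := exists_refl hΦ a b ha hb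
    have hA := hpos a ha
    apply key c hc
    · rw [hcaf, hcaf, rf_rf]; linarith
    · intro h
      apply hne
      rw [hcrf] at h
      have h' : rf a * (rf a * rf b * rf a) * rf a = rf a * rf a * rf a := by rw [h]
      simp only [mul_assoc, rf_mul_self, mul_one] at h'
      rwa [← mul_assoc, rf_mul_self, one_mul] at h'
    · have hin : (⟪a.1, c.1⟫ : ℝ) = - ⟪a.1, b.1⟫ := by
        rw [hc1, inner_sub_right, real_inner_smul_right]
        field_simp
        ring
      rw [hcaf, hin, af_rf]
      rw [af_rf] at h1
      set v := af b p
      set q : ℝ := af a p * ⟪a.1, b.1⟫ / ⟪a.1, a.1⟫ with hq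
      have e1 : af a p * (2 * ⟪a.1, b.1⟫ / ⟪a.1, a.1⟫) = 2 * q := by rw [hq]; ring
      have e2 : af a p * -⟪a.1, b.1⟫ / ⟪a.1, a.1⟫ = - q := by rw [hq]; ring
      rw [e1] at h1 ⊢
      rw [e2]
      have hv : v ≠ 0 := by intro h; rw [h] at h1; simp at h1
      have hv2 : 0 < v ^ 2 := by positivity
      have : v ^ 2 * ((v - 2 * q) * (v - 2 * q - -q)) ≤ 0 := by
        have := mul_pos_of_neg_of_neg h1 (neg_neg_of_pos h2)
        nlinarith
      by_contra hcon
      push Not at hcon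
      nlinarith [mul_pos hv2 hcon]

lemma finite_sd {m : ℕ} {Φ : Set (E m)} (hΦ : IsRootSystem Φ) (p : E m) (r : ℝ) :
    {b : E m × ℤ | b.1 ∈ Φ ∧ sd p b < r}.Finite := by
  have : {b : E m × ℤ | b.1 ∈ Φ ∧ sd p b < r} ⊆
      ⋃ α ∈ Φ, (fun k : ℤ => (α, k)) '' (Set.Icc ⌊⟪α, p⟫ - (r * ⟪α, α⟫ + 1)⌋
        ⌈⟪α, p⟫ + (r * ⟪α, α⟫ + 1)⌉) := by
    rintro ⟨α, k⟩ ⟨hα, hk⟩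
    simp only [Set.mem_iUnion]
    refine ⟨α, hα, k, ?_, rfl⟩
    have hA : (0:ℝ) < ⟪α, α⟫ := real_inner_self_pos.mpr (hΦ.ne_zero _ hα)
    simp only [sd, af] at hk
    rw [div_lt_iff₀ hA] at hk
    constructor
    · have : (⌊⟪α, p⟫ - (r * ⟪α, α⟫ + 1)⌋ : ℝ) ≤ k :=
        (Int.floor_le _).trans (by nlinarith [sq_nonneg (⟪α, p⟫ - (k:ℝ) - 1)])
      exact_mod_cast this
    · have : (k : ℝ) ≤ ⌈⟪α, p⟫ + (r * ⟪α, α⟫ + 1)⌉ :=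
        le_trans (by nlinarith [sq_nonneg (⟪α, p⟫ - (k:ℝ) + 1)]) (Int.le_ceil _)
      exact_mod_cast this
  refine Set.Finite.subset ?_ this
  exact hΦ.finite.biUnion fun α _ => (Set.finite_Icc _ _).image _

lemma rf_mem_closure {m : ℕ} {Φ : Set (E m)} (hΦ : IsRootSystem Φ) (p : E m) :
    ∀ (n : ℕ) (a : E m × ℤ), a.1 ∈ Φ →
      {b : E m × ℤ | b.1 ∈ Φ ∧ sd p b < sd p a}.ncard = n →
      rf a ∈ Subgroup.closure {w | ∃ b, Simp Φ p b ∧ w = rf b} := by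
  intro n
  induction n using Nat.strong_induction_on with
  | _ n ih =>
    intro a ha hn
    by_cases hs : Simp Φ p a
    · exact Subgroup.subset_closure ⟨a, hs, rfl⟩
    · obtain ⟨b, c, hb, hc, hbl, hcl, he⟩ := descent hΦ p a ha hs
      have lt : ∀ b : E m × ℤ, b.1 ∈ Φ → sd p b < sd p a →
          {d : E m × ℤ | d.1 ∈ Φ ∧ sd p d < sd p b}.ncard < n := by
        intro b hb hl
        rw [← hn]
        apply Set.ncard_lt_ncard _ (finite_sd hΦ p _)
        refine ⟨fun d hd => ⟨hd.1, hd.2.trans hl⟩, fun h => ?_⟩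
        exact lt_irrefl _ (h (show b ∈ _ from ⟨hb, hl⟩)).2
      have hbm := ih _ (lt b hb hbl) b hb rfl
      have hcm := ih _ (lt c hc hcl) c hc rfl
      rw [he]
      exact mul_mem (mul_mem hbm hcm) hbm

lemma exchange {m : ℕ} {Φ : Set (E m)} (hΦ : IsRootSystem Φ) (p : E m)
    (hp : ∀ a : E m × ℤ, a.1 ∈ Φ → af a p ≠ 0) :
    ∀ (L : List (Equiv.Perm (E m))), (∀ s ∈ L, ∃ b, Simp Φ p b ∧ s = rf b) →
      ∀ b : E m × ℤ, b.1 ∈ Φ → af b p * af b (L.prod p) < 0 →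
      ∃ M : List (Equiv.Perm (E m)), (∀ s ∈ M, ∃ b, Simp Φ p b ∧ s = rf b) ∧
        M.length + 1 = L.length ∧ rf b * L.prod = M.prod := by
  intro L
  induction L with
  | nil =>
    intro _ b _ h
    simp only [List.prod_nil, Equiv.Perm.one_apply] at h
    nlinarith [mul_self_nonneg (af b p)]
  | cons t L ih =>
    intro hL b hb h
    obtain ⟨a, ha, rfl⟩ := hL t (by simp)
    have hL' : ∀ s ∈ L, ∃ b, Simp Φ p b ∧ s = rf b := fun s hs => hL s (by simp [hs])
    rw [List.prod_cons, Equiv.Perm.mul_apply] at h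
    by_cases hsep : af b p * af b (rf a p) < 0
    · refine ⟨L, hL', by simp, ?_⟩
      rw [ha.2 b hb hsep, List.prod_cons, ← mul_assoc, rf_mul_self, one_mul]
    · obtain ⟨c, hc, hcaf, hcrf, -, -⟩ := exists_refl hΦ a b ha.1 hb
      have h1 : af b p ≠ 0 := hp b hb
      have h2 : af b (rf a p) ≠ 0 := by rw [← hcaf]; exact hp c hc
      have h3 : 0 < af b p * af b (rf a p) :=
        lt_of_le_of_ne (not_lt.mp hsep) (mul_ne_zero h1 h2).symm
      obtain ⟨M, hM, hlen, hprod⟩ := ih hL' c hc (by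
        rw [hcaf, hcaf]
        have h4 : 0 < af b p ^ 2 := by positivity
        have h5 := mul_neg_of_pos_of_neg h3 h
        by_contra hcon
        push Not at hcon
        nlinarith [mul_nonneg h4.le hcon])
      refine ⟨rf a :: M, ?_, by simp [hlen], ?_⟩
      · intro s hs
        rcases List.mem_cons.mp hs with rfl | hs
        · exact ⟨a, ha, rfl⟩
        · exact hM s hs
      · rw [List.prod_cons, List.prod_cons, ← hprod, hcrf]
        simp only [← mul_assoc, rf_mul_self, one_mul]

lemma word_trivial {m : ℕ} {Φ : Set (E m)} (hΦ : IsRootSystem Φ) (p : E m)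
    (hp : ∀ a : E m × ℤ, a.1 ∈ Φ → af a p ≠ 0) :
    ∀ (n : ℕ) (L : List (Equiv.Perm (E m))), L.length = n →
      (∀ s ∈ L, ∃ b, Simp Φ p b ∧ s = rf b) → L.prod p = p → L.prod = 1 := by
  intro n
  induction n using Nat.strong_induction_on with
  | _ n ih =>
    intro L hn hL hfix
    cases L with
    | nil => rfl
    | cons t L =>
      obtain ⟨a, ha, rfl⟩ := hL t (by simp)
      have hL' : ∀ s ∈ L, ∃ b, Simp Φ p b ∧ s = rf b := fun s hs => hL s (by simp [hs])
      have hu : L.prod p = rf a p := by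
        rw [List.prod_cons, Equiv.Perm.mul_apply] at hfix
        rw [← rf_rf a (L.prod p), hfix]
      have hA : ⟪a.1, a.1⟫ ≠ (0:ℝ) := (inner_self_ne_zero (𝕜 := ℝ)).mpr (hΦ.ne_zero _ ha.1)
      have hsep : af a p * af a (L.prod p) < 0 := by
        rw [hu, af_rf, mul_div_assoc, div_self hA]
        have := hp a ha.1
        have : 0 < af a p ^ 2 := by positivity
        nlinarith
      obtain ⟨M, hM, hlen, hprod⟩ := exchange hΦ p hp L hL' a ha.1 hsep
      rw [List.prod_cons] at hfix ⊢
      rw [hprod] at hfix ⊢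
      refine ih M.length ?_ M rfl hM hfix
      simp only [List.length_cons] at hn
      omega

lemma waff_free {m : ℕ} {Φ : Set (E m)} (hΦ : IsRootSystem Φ) (p : E m)
    (hp : p ∉ allWalls Φ) (w : Equiv.Perm (E m)) (hw : w ∈ Waff Φ) (hfix : w p = p) : w = 1 := by
  have hp' : ∀ a : E m × ℤ, a.1 ∈ Φ → af a p ≠ 0 := by
    intro a ha h
    apply hp
    simp only [allWalls, Set.mem_iUnion]
    exact ⟨a.1, ha, a.2, sub_eq_zero.mp h⟩
  have hle : Waff Φ ≤ Subgroup.closure {w | ∃ b, Simp Φ p b ∧ w = rf b} := by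
    unfold Waff
    rw [Subgroup.closure_le]
    rintro _ ⟨α, hα, k, rfl⟩
    exact rf_mem_closure hΦ p _ (α, k) hα rfl
  have hw' := hle hw
  rw [← Subgroup.mem_toSubmonoid, Subgroup.closure_toSubmonoid] at hw'
  obtain ⟨L, hL, rfl⟩ := Submonoid.exists_list_of_mem_closure hw'
  refine word_trivial hΦ p hp' _ L rfl ?_ hfix
  intro s hs
  rcases hL s hs with h | ⟨b, hb, h⟩
  · exact h
  · refine ⟨b, hb, ?_⟩
    rw [← inv_inv s, h]
    exact inv_eq_of_mul_eq_one_left (rf_mul_self b)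

lemma tube_eq {m : ℕ} (Φ : Set (E m)) (β x0 : E m) (hx0 : x0 ∈ (tubeWalls Φ β)ᶜ) :
    connectedComponentIn (tubeWalls Φ β)ᶜ x0 =
      {y | ∀ α ∈ Φ, ⟪α, β⟫ = (0:ℝ) →
        ((⌊⟪α, x0⟫⌋ : ℤ) : ℝ) < ⟪α, y⟫ ∧ ⟪α, y⟫ < ((⌊⟪α, x0⟫⌋ : ℤ) : ℝ) + 1} := by
  have hnot : ∀ y ∈ (tubeWalls Φ β)ᶜ, ∀ α ∈ Φ, ⟪α, β⟫ = (0:ℝ) → ∀ k : ℤ, ⟪α, y⟫ ≠ (k:ℝ) := by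
    intro y hy α hα hαβ k h
    apply hy
    simp only [tubeWalls, Set.mem_iUnion]
    exact ⟨α, ⟨hα, hαβ⟩, k, h⟩
  apply Set.Subset.antisymm
  · intro y hy α hα hαβ
    have hpre : IsPreconnected ((fun z : E m => (⟪α, z⟫ : ℝ)) ''
        connectedComponentIn (tubeWalls Φ β)ᶜ x0) :=
      isPreconnected_connectedComponentIn.image _ (by fun_prop)
    have hoc := hpre.ordConnected
    have hmx : (⟪α, x0⟫ : ℝ) ∈ (fun z : E m => (⟪α, z⟫ : ℝ)) ''
        connectedComponentIn (tubeWalls Φ β)ᶜ x0 := ⟨x0, mem_connectedComponentIn hx0, rfl⟩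
    have hmy : (⟪α, y⟫ : ℝ) ∈ (fun z : E m => (⟪α, z⟫ : ℝ)) ''
        connectedComponentIn (tubeWalls Φ β)ᶜ x0 := ⟨y, hy, rfl⟩
    have hk : ∀ k : ℤ, (k : ℝ) ∉ (fun z : E m => (⟪α, z⟫ : ℝ)) ''
        connectedComponentIn (tubeWalls Φ β)ᶜ x0 := by
      rintro k ⟨z, hz, h⟩
      exact hnot z (connectedComponentIn_subset _ _ hz) α hα hαβ k h
    constructor
    · by_contra hcon
      push Not at hcon
      exact hk _ (hoc.out hmy hmx ⟨hcon, Int.floor_le _⟩)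
    · by_contra hcon
      push Not at hcon
      refine hk (⌊⟪α, x0⟫⌋ + 1) (hoc.out hmx hmy ⟨?_, ?_⟩)
      · push_cast; exact (Int.lt_floor_add_one _).le
      · push_cast; exact hcon
  · apply IsPreconnected.subset_connectedComponentIn
    · apply Convex.isPreconnected
      intro y hy z hz a b ha hb hab α hα hαβ
      obtain ⟨h1, h2⟩ := hy α hα hαβ
      obtain ⟨h3, h4⟩ := hz α hα hαβ
      rw [inner_add_right, real_inner_smul_right, real_inner_smul_right]
      have hio := (convex_Ioo ((⌊⟪α, x0⟫⌋ : ℤ) : ℝ) (((⌊⟪α, x0⟫⌋ : ℤ) : ℝ) + 1))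
        (show (⟪α, y⟫ : ℝ) ∈ _ from ⟨h1, h2⟩) (show (⟪α, z⟫ : ℝ) ∈ _ from ⟨h3, h4⟩) ha hb hab
      exact hio
    · intro α hα hαβ
      refine ⟨lt_of_le_of_ne (Int.floor_le _) (hnot x0 hx0 α hα hαβ _).symm,
        Int.lt_floor_add_one _⟩
    · intro y hy hyw
      simp only [tubeWalls, Set.mem_iUnion] at hyw
      obtain ⟨α, ⟨hα, hαβ⟩, k, h⟩ := hyw
      obtain ⟨h1, h2⟩ := hy α hα hαβ
      have h : (⟪α, y⟫ : ℝ) = k := h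
      rw [h] at h1 h2
      have h1' : ⌊⟪α, x0⟫⌋ < k := by exact_mod_cast h1
      have h2' : k < ⌊⟪α, x0⟫⌋ + 1 := by exact_mod_cast h2
      omega

lemma bary_gt {m : ℕ} (S : Set (E m)) (hc : Convex ℝ S) (hb : Bornology.IsBounded S) (x : E m)
    (hx : IsBarycenter S x) (α : E m) (c : ℝ) (h : ∀ y ∈ S, c < ⟪α, y⟫) : c < ⟪α, x⟫ := by
  obtain ⟨F, hF, hne, rfl⟩ := hx
  have hcomp : IsCompact (closure S) := hb.isCompact_closure
  have hcl : ∀ y ∈ closure S, c ≤ ⟪α, y⟫ := by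
    have hclosed : IsClosed {y : E m | c ≤ ⟪α, y⟫} :=
      isClosed_le continuous_const (by fun_prop)
    exact fun y hy => closure_minimal (fun y hy => (h y hy).le) hclosed hy
  have hsub : ∀ v ∈ F, v ∈ closure S := by
    intro v hv
    have : v ∈ (F : Set (E m)) := hv
    rw [hF] at this
    exact extremePoints_subset this
  have hSne : S.Nonempty := by
    obtain ⟨v, hv⟩ := hne
    exact closure_nonempty_iff.mp ⟨v, hsub v hv⟩
  have hex : ∃ v ∈ F, c < ⟪α, v⟫ := by
    by_contra hcon
    push Not at hcon
    have hcl2 : closure S ⊆ {y : E m | ⟪α, y⟫ ≤ c} := by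
      rw [← closure_convexHull_extremePoints hcomp hc.closure, ← hF]
      apply closure_minimal _ (isClosed_le (by fun_prop) continuous_const)
      apply convexHull_min (fun v hv => hcon v hv)
      exact convex_halfSpace_le (innerₛₗ ℝ α).isLinear c
    obtain ⟨y, hy⟩ := hSne
    exact absurd (h y hy) (not_lt.mpr (hcl2 (subset_closure hy)))
  obtain ⟨v, hv, hlt⟩ := hex
  have hcard : (0:ℝ) < F.card := by exact_mod_cast hne.card_pos
  rw [real_inner_smul_right, inner_sum, lt_inv_mul_iff₀ hcard]
  calc (F.card : ℝ) * c = ∑ _y ∈ F, c := by simp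
    _ < ∑ y ∈ F, ⟪α, y⟫ := Finset.sum_lt_sum (fun y hy => hcl y (hsub y hy)) ⟨v, hv, hlt⟩

lemma slab_bounded {m : ℕ} (B ω : Fin m → E m) (hind : LinearIndependent ℝ B)
    (hω : IsFundamentalCoweights B ω) (i : Fin m) (S : Set (E m)) (lo : Fin m → ℝ)
    (h1 : ∀ y ∈ S, ∀ j, j ≠ i → lo j ≤ ⟪B j, y⟫ ∧ ⟪B j, y⟫ ≤ lo j + 1)
    (h2 : ∀ y ∈ S, ⟪ω i, y⟫ = (0:ℝ)) : Bornology.IsBounded S := by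
  classical
  let M : E m →ₗ[ℝ] (Fin m → ℝ) :=
    LinearMap.pi fun j => if j = i then innerₛₗ ℝ (ω i) else innerₛₗ ℝ (B j)
  have hMi : ∀ y, M y i = ⟪ω i, y⟫ := fun y => by simp [M]
  have hMj : ∀ y j, j ≠ i → M y j = ⟪B j, y⟫ := fun y j hj => by simp [M, hj]
  have hspan : Submodule.span ℝ (Set.range B) = ⊤ :=
    hind.span_eq_top_of_card_eq_finrank' (by simp)
  have hker : LinearMap.ker M = ⊥ := by
    rw [LinearMap.ker_eq_bot']
    intro y hy
    have hz : y - (⟪B i, y⟫ : ℝ) • ω i = 0 := by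
      have hall : ∀ j, ⟪B j, y - (⟪B i, y⟫ : ℝ) • ω i⟫ = (0:ℝ) := by
        intro j
        rw [inner_sub_right, real_inner_smul_right, hω j i]
        by_cases hj : j = i
        · subst hj; simp
        · rw [← hMj y j hj, hy]; simp [hj]
      have hort : ∀ v ∈ Submodule.span ℝ (Set.range B),
          ⟪v, y - (⟪B i, y⟫ : ℝ) • ω i⟫ = (0:ℝ) := by
        intro v hv
        induction hv using Submodule.span_induction with
        | mem v hv => obtain ⟨j, rfl⟩ := hv; exact hall j
        | zero => simp
        | add u v _ _ hu hv => rw [inner_add_left, hu, hv, add_zero]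
        | smul a v _ hv => rw [real_inner_smul_left, hv, mul_zero]
      rw [← inner_self_eq_zero (𝕜 := ℝ)]
      exact hort _ (by rw [hspan]; trivial)
    have hy' : y = (⟪B i, y⟫ : ℝ) • ω i := sub_eq_zero.mp hz
    have h0 : (⟪ω i, y⟫ : ℝ) = 0 := by rw [← hMi, hy]; rfl
    rw [← inner_self_eq_zero (𝕜 := ℝ)]
    nth_rewrite 1 [hy']
    rw [real_inner_smul_left, h0, mul_zero]
  obtain ⟨K, -, hK⟩ := LinearMap.exists_antilipschitzWith M hker
  refine (hK.isBounded_preimage (Metric.isBounded_Icc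
    (fun j => if j = i then 0 else lo j) (fun j => if j = i then 0 else lo j + 1))).subset ?_
  intro y hy
  refine ⟨fun j => ?_, fun j => ?_⟩ <;> by_cases hj : j = i
  · subst hj; simp [hMi, h2 y hy]
  · simp [hMj y j hj, hj, (h1 y hy j hj).1]
  · subst hj; simp [hMi, h2 y hy]
  · simp [hMj y j hj, hj, (h1 y hy j hj).2]

/-- The centerline `ℒ = x + ℝ β∨`. -/
def centerline (x β : E m) : Set (E m) := {p | ∃ t : ℝ, p = x + t • β}


/-- The centerline `ℒ = x + ℝ β∨` of a geodesic tube `𝒯` of direction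
`β∨ = ω_i∨` (where `x` is the barycenter of `𝒯 ∩ A_I`, `A_I = (ℝβ∨)^⊥`) intersects some
alcove; in particular any element of `W^aff` fixing `ℒ` pointwise is the identity. -/
theorem centerline_meets_alcove {m : ℕ} (Φ : Set (E m)) (hΦ : IsRootSystem Φ)
    (B ω : Fin m → E m) (hB : IsSimpleSystem Φ B) (hω : IsFundamentalCoweights B ω)
    (i : Fin m) (T : Set (E m)) (hT : IsGeodesicTube Φ (ω i) T)
    (x : E m) (hx : IsBarycenter (T ∩ {y : E m | ⟪ω i, y⟫ = (0:ℝ)}) x) :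
    (∃ C, IsAlcove Φ C ∧ (centerline x (ω i) ∩ C).Nonempty) ∧
      (∀ w ∈ Waff Φ, (∀ p ∈ centerline x (ω i), (w : Equiv.Perm (E m)) p = p) → w = 1) := by
  have hreg : ∃ t : ℝ, x + t • ω i ∈ (allWalls Φ)ᶜ := by
    obtain ⟨x0, hx0, rfl⟩ := hT
    rw [tube_eq Φ (ω i) x0 hx0] at hx
    set S := {y : E m | ∀ α ∈ Φ, ⟪α, ω i⟫ = (0:ℝ) →
        ((⌊⟪α, x0⟫⌋ : ℤ) : ℝ) < ⟪α, y⟫ ∧ ⟪α, y⟫ < ((⌊⟪α, x0⟫⌋ : ℤ) : ℝ) + 1} ∩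
        {y : E m | ⟪ω i, y⟫ = (0:ℝ)} with hS
    have hconv : Convex ℝ S := by
      intro y hy z hz a b ha hb hab
      refine ⟨fun α hα hαβ => ?_, ?_⟩
      · rw [inner_add_right, real_inner_smul_right, real_inner_smul_right]
        have hio := (convex_Ioo ((⌊⟪α, x0⟫⌋ : ℤ) : ℝ) (((⌊⟪α, x0⟫⌋ : ℤ) : ℝ) + 1))
          (show (⟪α, y⟫ : ℝ) ∈ _ from hy.1 α hα hαβ)
          (show (⟪α, z⟫ : ℝ) ∈ _ from hz.1 α hα hαβ) ha hb hab
        exact hio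
      · have h1 : (⟪ω i, y⟫ : ℝ) = 0 := hy.2
        have h2 : (⟪ω i, z⟫ : ℝ) = 0 := hz.2
        show (⟪ω i, a • y + b • z⟫ : ℝ) = 0
        rw [inner_add_right, real_inner_smul_right, real_inner_smul_right, h1, h2]
        simp
    have hbdd : Bornology.IsBounded S := by
      refine slab_bounded B ω hB.indep hω i S (fun j => ((⌊⟪B j, x0⟫⌋ : ℤ) : ℝ)) ?_ ?_
      · intro y hy j hj
        have := hy.1 (B j) (hB.mem j) (by rw [hω j i, if_neg hj])
        exact ⟨this.1.le, this.2.le⟩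
      · exact fun y hy => hy.2
    have htube : ∀ α ∈ Φ, ⟪α, ω i⟫ = (0:ℝ) → ∀ k : ℤ, ⟪α, x⟫ ≠ (k:ℝ) := by
      intro α hα hαβ k h
      have h1 := bary_gt S hconv hbdd x hx α _ (fun y hy => (hy.1 α hα hαβ).1)
      have h2 := bary_gt S hconv hbdd x hx (-α) (-(((⌊⟪α, x0⟫⌋ : ℤ) : ℝ) + 1))
        (fun y hy => by rw [inner_neg_left]; exact neg_lt_neg (hy.1 α hα hαβ).2)
      rw [inner_neg_left, neg_lt_neg_iff] at h2
      rw [h] at h1 h2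
      have h1' : ⌊⟪α, x0⟫⌋ < k := by exact_mod_cast h1
      have h2' : k < ⌊⟪α, x0⟫⌋ + 1 := by exact_mod_cast h2
      omega
    have hcount : (⋃ α ∈ Φ, Set.range fun k : ℤ =>
        ((k : ℝ) - ⟪α, x⟫) / ⟪α, ω i⟫).Countable :=
      hΦ.finite.countable.biUnion fun α _ => Set.countable_range _
    obtain ⟨t, ht⟩ := (hcount.dense_compl ℝ).nonempty
    refine ⟨t, fun hmem => ?_⟩
    simp only [allWalls, Set.mem_iUnion] at hmem
    obtain ⟨α, hα, k, h⟩ := hmem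
    have h : (⟪α, x + t • ω i⟫ : ℝ) = k := h
    rw [inner_add_right, real_inner_smul_right] at h
    by_cases hαβ : (⟪α, ω i⟫ : ℝ) = 0
    · rw [hαβ, mul_zero, add_zero] at h
      exact htube α hα hαβ k h
    · apply ht
      simp only [Set.mem_iUnion]
      refine ⟨α, hα, k, ?_⟩
      simp only
      field_simp
      linarith
  obtain ⟨t, ht⟩ := hreg
  refine ⟨⟨_, ⟨_, ht, rfl⟩, x + t • ω i, ⟨t, rfl⟩, mem_connectedComponentIn ht⟩, ?_⟩
  intro w hw hfix
  exact waff_free hΦ _ ht w hw (hfix _ ⟨t, rfl⟩)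


end
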